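/- For every integer n ≥ 3 and every field K, there exist a field L, an integer r ≥ 1, and an injective ring homomorphism from the monoid algebra K[C_n] into the ring of r × r matrices over L. -/

import Mathlib

namespace HK

/-- The generator `x_k` of the free monoid on `ZMod n` (indices taken mod `n`,
so `x_n` is the letter `0`). -/
def fx (n k : ℕ) : FreeMonoid (ZMod n) := FreeMonoid.of (k : ZMod n)

/-- The ascending word `x_a x_{a+1} ⋯ x_b` (empty if `b < a`). -/
def asc (n a b : ℕ) : FreeMonoid (ZMod n) :=
  FreeMonoid.ofList ((List.range' a (b + 1 - a)).map fun k => (k : ZMod n))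

/-- The descending word `x_a x_{a-1} ⋯ x_b` (empty if `a < b`). -/
def desc (n a b : ℕ) : FreeMonoid (ZMod n) :=
  FreeMonoid.ofList (((List.range' b (a + 1 - b)).map fun k => (k : ZMod n)).reverse)

/-- `x_a ⋯ x_b`: ascending if `a ≤ b`, descending otherwise. -/
def seg (n a b : ℕ) : FreeMonoid (ZMod n) := if a ≤ b then asc n a b else desc n a b

/-- The word `q_i = x_1 ⋯ x_i x_{n-1} x_{n-2} ⋯ x_{i+1}`. -/
def qw (n i : ℕ) : FreeMonoid (ZMod n) := asc n 1 i * desc n (n - 1) (i + 1)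

/-- `|u|_c`: the number of occurrences of the letter `c` in the word `u`. -/
def cnt (n : ℕ) (u : FreeMonoid (ZMod n)) (c : ZMod n) : ℕ :=
  (FreeMonoid.toList u).count c

/-- `w` is a factor of `v`. -/
def IsFactor {α : Type*} (w v : FreeMonoid α) : Prop := ∃ v₁ v₂, v = v₁ * w * v₂

/-- A word is reduced if it contains no factor of the forms (1)–(5). -/
def Reduced (n : ℕ) (w : FreeMonoid (ZMod n)) : Prop :=
  (∀ i : ℕ, 1 ≤ i → i ≤ n → ¬ IsFactor (fx n i * fx n i) w) ∧
  (∀ i j : ℕ, 1 ≤ i → j ≤ n → 1 < j - i → j - i < n - 1 →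
      ¬ IsFactor (fx n j * fx n i) w) ∧
  (∀ i j : ℕ, 1 ≤ i → i + 1 < j → j < n - 1 →
      ¬ IsFactor (fx n n * asc n 1 i * fx n j) w) ∧
  (∀ i : ℕ, ∀ u : FreeMonoid (ZMod n), 1 ≤ i → i ≤ n → u ≠ 1 →
      cnt n u (i : ZMod n) = 0 → cnt n u ((i : ZMod n) - 1) = 0 →
      ¬ IsFactor (fx n i * u * fx n i) w) ∧
  (∀ i : ℕ, ∀ u : FreeMonoid (ZMod n), 1 ≤ i → i ≤ n → u ≠ 1 →
      cnt n u (i : ZMod n) = 0 → cnt n u ((i : ZMod n) + 1) = 0 →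
      ¬ IsFactor (fx n i * u * fx n i) w)

/-- Membership in the set `A_i`. -/
def InA (n i : ℕ) (a : FreeMonoid (ZMod n)) : Prop :=
  ∃ (s : ℕ) (k : ℕ → ℕ),
    s ≤ i + 1 ∧
    (1 ≤ s → 1 ≤ k s ∧ k s ≤ s) ∧
    (∀ t, s + 1 ≤ t → t ≤ i + 1 → t < k t ∧ k t ≤ n - 1) ∧
    (∀ t, s + 1 ≤ t → t + 1 ≤ i + 1 → k t < k (t + 1)) ∧
    ∃ p : FreeMonoid (ZMod n),
      p * a = (if s = 0 then 1 else seg n (k s) s) *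
        ((List.range' (s + 1) (i + 1 - s)).map fun t => seg n (k t) t).prod

/-- Membership in the set `B_i`. -/
def InB (n i : ℕ) (b : FreeMonoid (ZMod n)) : Prop :=
  ∃ (r : ℕ) (I J : ℕ → ℕ),
    (∀ t, 1 ≤ t → t ≤ r → 1 ≤ I t ∧ I t < i + 1) ∧
    (∀ t, 1 ≤ t → t + 1 ≤ r → I (t + 1) < I t) ∧
    i + 1 < J 1 ∧
    (∀ t, 1 ≤ t → t + 1 ≤ r + 1 → J t < J (t + 1)) ∧
    J (r + 1) ≤ n ∧
    ∃ p : FreeMonoid (ZMod n),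
      b * p = ((List.range' 1 r).map fun t =>
          fx n n * asc n 1 (I t) * desc n (n - 1) (J t)).prod *
        (fx n n * desc n (n - 1) (J (r + 1)))

/-- The defining relations of the Hecke–Kiselman monoid of the oriented cycle. -/
def cnRel (n : ℕ) : FreeMonoid (ZMod n) → FreeMonoid (ZMod n) → Prop := fun w v =>
  (∃ a : ZMod n, w = FreeMonoid.of a * FreeMonoid.of a ∧ v = FreeMonoid.of a) ∨
  (∃ a b : ZMod n, b ≠ a + 1 ∧ a ≠ b + 1 ∧
    w = FreeMonoid.of a * FreeMonoid.of b ∧ v = FreeMonoid.of b * FreeMonoid.of a) ∨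
  (∃ a : ZMod n,
    (w = FreeMonoid.of a * FreeMonoid.of (a + 1) * FreeMonoid.of a ∨
     w = FreeMonoid.of (a + 1) * FreeMonoid.of a * FreeMonoid.of (a + 1)) ∧
    v = FreeMonoid.of a * FreeMonoid.of (a + 1))

/-- The Hecke–Kiselman monoid `C_n` of the oriented cycle of length `n`. -/
abbrev Cn (n : ℕ) := (conGen (cnRel n)).Quotient

/-- The canonical projection `F → C_n`. -/
def pr (n : ℕ) : FreeMonoid (ZMod n) →* Cn n := (conGen (cnRel n)).mk'

/-- The ideal `I_i` of `C_n`. -/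
def Iset (n i : ℕ) : Set (Cn n) :=
  {w | ¬ ∃ (u v : Cn n) (k : ℕ), 1 ≤ k ∧ u * w * v = (pr n (fx n n * qw n i)) ^ k}


/-- Displacement functions. -/
def Disp (n : ℕ) := ZMod n → ℕ

namespace Disp
variable {n : ℕ}

def dmul (e d : Disp n) : Disp n := fun a => d a + e (a - (d a : ZMod n))

instance : Monoid (Disp n) where
  mul := dmul
  one := fun _ => 0
  mul_assoc f e d := by
    funext a
    change d a + (dmul f e) (a - (d a : ZMod n)) = _
    change _ = (dmul e d) a + f (a - ((dmul e d a : ℕ) : ZMod n))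
    simp only [dmul]
    push_cast
    rw [add_assoc, sub_sub]
  one_mul d := by funext a; rfl
  mul_one d := by
    funext a
    change 0 + d (a - ((0 : ℕ) : ZMod n)) = d a
    simp

theorem mul_app (e d : Disp n) (a : ZMod n) : (e * d) a = d a + e (a - (d a : ZMod n)) := rfl
theorem one_app (a : ZMod n) : (1 : Disp n) a = 0 := rfl

def gen (i : ZMod n) : Disp n := fun a => if a = i + 1 then 1 else 0

theorem gen_app (i a : ZMod n) : gen i a = if a = i + 1 then 1 else 0 := rfl

theorem gen_mul_app (i : ZMod n) (d : Disp n) (a : ZMod n) :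
    (gen i * d) a = if a - (d a : ZMod n) = i + 1 then d a + 1 else d a := by
  rw [mul_app, gen_app]; split_ifs <;> rfl

theorem ext' {d e : Disp n} (h : ∀ a, d a = e a) : d = e := funext h

/-- the lifting operation -/
def U (i : ZMod n) (d : Disp n) : Disp n :=
  fun a => if a - (d a : ZMod n) = i ∧ 0 < d a then d a - 1 else d a

theorem U_app (i : ZMod n) (d : Disp n) (a : ZMod n) :
    U i d a = if a - (d a : ZMod n) = i ∧ 0 < d a then d a - 1 else d a := rfl

end Disp

open Disp

theorem one_ne {n : ℕ} (hn : 3 ≤ n) : (1 : ZMod n) ≠ 0 := by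
  haveI : Fact (1 < n) := ⟨by omega⟩
  exact one_ne_zero

theorem two_ne {n : ℕ} (hn : 3 ≤ n) : (1 + 1 : ZMod n) ≠ 0 := by
  intro h
  have h2 : ((2 : ℕ) : ZMod n) = 0 := by push_cast; rw [← h]; norm_num
  rw [ZMod.natCast_eq_zero_iff] at h2
  exact absurd (Nat.le_of_dvd (by norm_num) h2) (by omega)

theorem gen_rel {n : ℕ} (hn : 3 ≤ n) (w v : FreeMonoid (ZMod n)) (h : cnRel n w v) :
    FreeMonoid.lift (gen (n := n)) w = FreeMonoid.lift (gen (n := n)) v := by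
  have h1 := one_ne hn
  have h2 := two_ne hn
  have h3 : ∀ x y : ZMod n, x = y + 1 → x = y + 1 + 1 → False := by
    intro x y hx hy
    apply h1
    linear_combination hx - hy
  rcases h with ⟨a, rfl, rfl⟩ | ⟨a, b, hab, hba, rfl, rfl⟩ | ⟨a, (rfl | rfl), rfl⟩ <;>
  simp only [map_mul, FreeMonoid.lift_eval_of] <;> apply ext' <;> intro c <;>
  simp only [mul_app, gen_app] <;> split_ifs <;> push_cast at * <;> grind

/-- The action map. -/
def act {n : ℕ} (hn : 3 ≤ n) : Cn n →* Disp n :=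
  (conGen (cnRel n)).lift (FreeMonoid.lift gen) (Con.conGen_le.2 (fun w v h => gen_rel hn w v h))

def gX {n : ℕ} (i : ZMod n) : Cn n := pr n (FreeMonoid.of i)

theorem act_gX {n : ℕ} (hn : 3 ≤ n) (i : ZMod n) : act hn (gX i) = gen i := by
  simp [act, gX, pr]

theorem Cn_induct {n : ℕ} {P : Cn n → Prop} (h1 : P 1) (hm : ∀ i w, P w → P (gX i * w))
    (w : Cn n) : P w := by
  induction w using Con.induction_on with
  | _ w =>
    induction w using FreeMonoid.inductionOn' with
    | one => exact h1
    | of_mul i w ih => exact hm i _ ih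

theorem pr_rel {n : ℕ} {w v : FreeMonoid (ZMod n)} (h : cnRel n w v) : pr n w = pr n v :=
  (Con.eq _).2 (ConGen.Rel.of _ _ h)

theorem gX_idem {n : ℕ} (i : ZMod n) : gX i * gX i = gX i :=
  pr_rel (Or.inl ⟨i, rfl, rfl⟩)
theorem gX_comm {n : ℕ} {i j : ZMod n} (h : j ≠ i + 1) (h' : i ≠ j + 1) :
    gX i * gX j = gX j * gX i :=
  pr_rel (Or.inr (Or.inl ⟨i, j, h, h', rfl, rfl⟩))
theorem gX_l {n : ℕ} (i : ZMod n) : gX i * gX (i + 1) * gX i = gX i * gX (i + 1) :=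
  pr_rel (Or.inr (Or.inr ⟨i, Or.inl rfl, rfl⟩))
theorem gX_r {n : ℕ} (i : ZMod n) : gX (i + 1) * gX i * gX (i + 1) = gX i * gX (i + 1) :=
  pr_rel (Or.inr (Or.inr ⟨i, Or.inr rfl, rfl⟩))

theorem act_mul {n : ℕ} (hn : 3 ≤ n) (i : ZMod n) (w : Cn n) (a : ZMod n) :
    act hn (gX i * w) a =
      if a - (act hn w a : ZMod n) = i + 1 then act hn w a + 1 else act hn w a := by
  rw [map_mul, act_gX, gen_mul_app]

theorem lemA {n : ℕ} (hn : 3 ≤ n) (w : Cn n) : ∀ i : ZMod n,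
    (∀ a, a - (act hn w a : ZMod n) ≠ i + 1) → gX i * w = w := by
  have h1 := one_ne hn
  have h2 := two_ne hn
  induction w using Cn_induct with
  | h1 =>
    intro i h
    exact absurd (by simp [one_app]) (h (i + 1))
  | hm j w ih =>
    intro i h
    simp only [act_mul] at h
    by_cases hij : j = i
    · subst hij; rw [← mul_assoc, gX_idem]
    have key : j ≠ i → ∀ a, a - (act hn w a : ZMod n) ≠ i + 1 := by
      intro hij a ha
      have := h a
      rw [if_neg (by grind)] at this
      exact this ha
    by_cases hj1 : j = i + 1
    · subst hj1
      have e1 := ih i (key hij)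
      have e2 := ih (i + 1) (by
        intro a ha
        have := h a
        rw [if_pos ha] at this
        push_cast at this
        grind)
      have e3 : gX (i + 1) * w = w := e2
      rw [e3, e1]
    · by_cases hj2 : i = j + 1
      · subst hj2
        have e1 := ih _ (key hij)
        calc gX (j + 1) * (gX j * w) = gX (j + 1) * (gX j * (gX (j + 1) * w)) := by rw [e1]
          _ = gX (j + 1) * gX j * gX (j + 1) * w := by simp only [mul_assoc]
          _ = gX j * w := by rw [gX_r, mul_assoc, e1]
      · rw [← mul_assoc, gX_comm hj1 hj2, mul_assoc, ih _ (key hij)]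

theorem lemD {n : ℕ} (hn : 3 ≤ n) (i : ZMod n) (w : Cn n) :
    ∃ y, gX i * w = gX i * y ∧ act hn y = U i (act hn w) := by
  have h1 := one_ne hn
  have h2 := two_ne hn
  induction w using Cn_induct with
  | h1 =>
    refine ⟨1, rfl, ?_⟩
    apply ext'; intro a
    simp [one_app, U_app]
  | hm j w ih =>
    obtain ⟨y, hy, hU⟩ := ih
    by_cases hij : j = i
    · subst hij
      refine ⟨y, by rw [← mul_assoc, gX_idem, hy], ?_⟩
      rw [hU]
      apply ext'; intro a
      simp only [U_app, act_mul]
      split_ifs <;> push_cast at * <;> grind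
    by_cases hj1 : j = i + 1
    · subst hj1
      refine ⟨gX (i + 1) * y, ?_, ?_⟩
      · rw [← mul_assoc, ← mul_assoc, ← gX_l, mul_assoc, hy]
        simp only [mul_assoc]
      · apply ext'; intro a
        simp only [U_app, act_mul, hU]
        have := Nat.cast_pred (R := ZMod n) (n := act hn w a)
        split_ifs <;> push_cast at * <;> grind
    · by_cases hj2 : i = j + 1
      · subst hj2
        refine ⟨gX j * w, rfl, ?_⟩
        apply ext'; intro a
        simp only [U_app, act_mul]
        split_ifs <;> push_cast at * <;> grind
      · refine ⟨gX j * y, ?_, ?_⟩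
        · rw [← mul_assoc, gX_comm hj1 hj2, mul_assoc, hy, ← mul_assoc, ← gX_comm hj1 hj2,
            mul_assoc]
        · apply ext'; intro a
          simp only [U_app, act_mul, hU]
          have := Nat.cast_pred (R := ZMod n) (n := act hn w a)
          split_ifs <;> push_cast at * <;> grind

theorem act_inj {n : ℕ} (hn : 3 ≤ n) : Function.Injective (act hn) := by
  haveI : NeZero n := ⟨by omega⟩
  have key : ∀ m : ℕ, ∀ u v : Cn n, (∑ a, act hn u a) = m → act hn u = act hn v → u = v := by
    intro m
    induction m using Nat.strong_induction_on with
    | _ m IH =>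
      intro u
      have noim : ∀ (i : ZMod n) (w : Cn n) (a), a - (act hn (gX i * w) a : ZMod n) ≠ i + 1 := by
        intro i w a
        have h1 := one_ne hn
        rw [act_mul]
        split_ifs with h
        · push_cast; grind
        · exact h
      induction u using Cn_induct with
      | h1 =>
        intro v _ hv
        induction v using Cn_induct with
        | h1 => rfl
        | hm i w _ =>
          exfalso
          have := noim i w (i + 1)
          rw [← hv] at this
          simp [one_app] at this
      | hm i u' ihu =>
        intro v hm huv
        by_cases hc : ∀ a, a - (act hn u' a : ZMod n) ≠ i + 1
        · have e := lemA hn u' i hc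
          rw [e] at hm huv ⊢
          exact ihu v hm huv
        · push Not at hc
          obtain ⟨a, ha⟩ := hc
          have hn1 := noim i u'
          have eu := lemA hn _ i hn1
          rw [huv] at hn1
          have ev := lemA hn _ i hn1
          obtain ⟨y, hy, hyU⟩ := lemD hn i (gX i * u')
          obtain ⟨z, hz, hzU⟩ := lemD hn i v
          have hyz : y = z := by
            refine IH (∑ a, act hn y a) ?_ y z rfl ?_
            · rw [← hm]
              apply Finset.sum_lt_sum
              · intro b _
                rw [hyU, U_app]; split_ifs <;> omega
              · refine ⟨a, Finset.mem_univ _, ?_⟩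
                rw [hyU, U_app]
                have hb := act_mul hn i u' a
                rw [if_pos ha] at hb
                rw [hb, if_pos]
                · omega
                · refine ⟨?_, by omega⟩
                  push_cast
                  rw [← sub_sub, ha]; ring
            · rw [hyU, hzU, huv]
          rw [← eu, ← ev, hy, hz, hyz]
  intro u v h
  exact key _ u v rfl h

open Classical in
/-- The monomial matrix representation of displacement functions. -/
noncomputable def Phi (n : ℕ) [NeZero n] (K : Type*) [Field K] :
    Disp n →* Matrix (ZMod n → ZMod n) (ZMod n → ZMod n) (MvPolynomial (ZMod n) K) where
  toFun d := Matrix.of fun b a =>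
    if b = (fun k => a k - (d (a k) : ZMod n)) then ∏ k, MvPolynomial.X k ^ d (a k) else 0
  map_one' := by
    ext1 b a
    simp [one_app, Matrix.one_apply]
  map_mul' e d := by
    ext1 b a
    simp only [Matrix.mul_apply, Matrix.of_apply, mul_ite, mul_zero, Finset.sum_ite_eq',
      Finset.sum_ite_eq, Finset.mem_univ, if_true, mul_app]
    push_cast
    simp only [sub_sub, pow_add, Finset.prod_mul_distrib]
    split_ifs
    · rw [mul_comm]
    · rw [zero_mul]

theorem Phi_col (n : ℕ) [NeZero n] (K : Type*) [Field K] (d : Disp n) :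
    ∑ b, Phi n K d b id = MvPolynomial.monomial (Finsupp.equivFunOnFinite.symm d) (1 : K) := by
  classical
  simp only [Phi, MonoidHom.coe_mk, OneHom.coe_mk, Matrix.of_apply, Finset.sum_ite_eq',
      Finset.sum_ite_eq, Finset.mem_univ, if_true, id]
  rw [MvPolynomial.monomial_eq, Finsupp.prod_fintype _ _ (by simp)]
  simp only [map_one, one_mul]
  rfl

theorem lift_inj {n : ℕ} (hn : 3 ≤ n) [NeZero n] (K : Type*) [Field K] :
    Function.Injective (MonoidAlgebra.lift K
      (Matrix (ZMod n → ZMod n) (ZMod n → ZMod n) (MvPolynomial (ZMod n) K)) (Cn n)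
      ((Phi n K).comp (act hn))) := by
  classical
  rw [injective_iff_map_eq_zero]
  intro x hx
  have hcol : x.coeff.sum (fun w c => c • MvPolynomial.monomial
      (Finsupp.equivFunOnFinite.symm (act hn w)) (1 : K)) = 0 := by
    have := congrArg (fun M : Matrix (ZMod n → ZMod n) (ZMod n → ZMod n)
      (MvPolynomial (ZMod n) K) => ∑ b, M b id) hx
    simp only [MonoidAlgebra.lift_apply, Finsupp.sum, Matrix.sum_apply, Matrix.smul_apply,
      Matrix.zero_apply, Finset.sum_const_zero] at this
    rw [Finset.sum_comm] at this
    simp only [← Finset.smul_sum, MonoidHom.comp_apply, Phi_col] at this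
    exact this
  ext w
  change x.coeff w = 0
  have hinj : ∀ v w : Cn n, (Finsupp.equivFunOnFinite.symm (act hn v) =
      Finsupp.equivFunOnFinite.symm (act hn w)) ↔ v = w := fun v w =>
    (Finsupp.equivFunOnFinite.symm.injective.eq_iff).trans (act_inj hn).eq_iff
  have h2 := congrArg (MvPolynomial.coeff (Finsupp.equivFunOnFinite.symm (act hn w))) hcol
  simp only [Finsupp.sum, MvPolynomial.coeff_sum, MvPolynomial.coeff_smul,
    MvPolynomial.coeff_monomial, hinj] at h2
  simpa using h2

/-- Corollary 5.7: `K[C_n]` embeds into a matrix ring over a field. -/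
theorem stmt19.{u} (n : ℕ) (hn : 3 ≤ n) (K : Type u) [Field K] :
    ∃ (L : Type u) (_ : Field L) (r : ℕ), 1 ≤ r ∧
      ∃ f : MonoidAlgebra K (Cn n) →+* Matrix (Fin r) (Fin r) L,
        Function.Injective f := by
  classical
  haveI : NeZero n := ⟨by omega⟩
  let R := MvPolynomial (ZMod n) K
  let L := FractionRing R
  refine ⟨L, inferInstance, Fintype.card (ZMod n → ZMod n), Fintype.card_pos, ?_⟩
  let e := Fintype.equivFin (ZMod n → ZMod n)
  refine ⟨((Matrix.reindexAlgEquiv L L e).toRingEquiv.toRingHom.comp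
    (algebraMap R L).mapMatrix).comp (MonoidAlgebra.lift K
      (Matrix (ZMod n → ZMod n) (ZMod n → ZMod n) (MvPolynomial (ZMod n) K)) (Cn n)
      ((Phi n K).comp (act hn))).toRingHom, ?_⟩
  have i1 : Function.Injective ((algebraMap R L).mapMatrix (m := ZMod n → ZMod n)) :=
    Matrix.map_injective (IsFractionRing.injective R L)
  exact ((Matrix.reindexAlgEquiv L L e).injective.comp i1).comp (lift_inj hn K)

end HK
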